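/- Let s be a positive natural number and let u, v : Fin s → ℝ satisfy ⌊u i − u j⌋ = ⌊v i − v j⌋ for all indices i, j. Then there exists a permutation σ of Fin s such that both u ∘ σ and v ∘ σ are in increasing order. -/

import Mathlib

/-- The order of fractional parts relative to a base point is determined by floors. -/
lemma fract_le_iff_floor (a b c : ℝ) :
    Int.fract (a - c) ≤ Int.fract (b - c) ↔ ⌊b - c⌋ - ⌊a - c⌋ ≤ ⌊b - a⌋ := by
  rw [Int.le_floor]
  unfold Int.fract
  push_cast
  constructor <;> intro h <;> linarith

theorem common_increasing_perm (s : ℕ) [NeZero s] (u v : Fin s → ℝ)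
    (h : ∀ i j : Fin s, ⌊u i - u j⌋ = ⌊v i - v j⌋) :
    ∃ σ : Equiv.Perm (Fin s),
      Monotone (fun i : Fin s => Int.fract (u (σ i) - u (σ 0))) ∧
      Monotone (fun i : Fin s => Int.fract (v (σ i) - v (σ 0))) := by
  set f : Fin s → ℝ := fun i => Int.fract (u i - u 0) with hf
  set σ := Tuple.sort f with hσ
  have hm : Monotone (f ∘ σ) := Tuple.monotone_sort f
  have h0 : f (σ 0) = 0 := by
    have h1 : f (σ 0) ≤ f (σ (σ.symm 0)) := hm (Fin.zero_le _)
    have h2 : f 0 = 0 := by simp [hf]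
    rw [Equiv.apply_symm_apply, h2] at h1
    exact le_antisymm h1 (Int.fract_nonneg _)
  have hk : u (σ 0) - u 0 = (⌊u (σ 0) - u 0⌋ : ℝ) := by
    have := Int.floor_add_fract (u (σ 0) - u 0)
    have h0' : Int.fract (u (σ 0) - u 0) = 0 := h0
    linarith
  have he : ∀ i, Int.fract (u i - u (σ 0)) = f i := by
    intro i
    have : u i - u (σ 0) = (u i - u 0) - (⌊u (σ 0) - u 0⌋ : ℝ) := by
      rw [← hk]; ring
    rw [this, Int.fract_sub_intCast]
  have hu : Monotone (fun i : Fin s => Int.fract (u (σ i) - u (σ 0))) := by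
    intro i j hij
    simp only [he]
    exact hm hij
  refine ⟨σ, hu, fun i j hij => ?_⟩
  have := hu hij
  simp only [fract_le_iff_floor, h] at this ⊢
  exact this
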